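/- arXiv:2509.03030 — 2 statements merged into one kernel-verified Lean document; each statement's English description precedes it below -/
import Mathlib

section
/- Let A be a nonempty finite set, τ > 0, k ≥ 1 an integer, and Q^0, …, Q^k : A → ℝ. Define the policy π^{k-1} = softmax_τ(Σ_{i=0}^{k-1} Q^i) and the regularized Q-function Q̃^k = Q^k + τ·log∘π^{k-1}. Then softmax_τ(Q̃^k) = softmax_τ(Σ_{i=0}^{k} Q^i). (This is Theorem 1 of the paper, applied at each fixed time step n, state x, and mean-field distribution μ.) -/
/-- Softmax with temperature `τ` of `f : A → ℝ`. -/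
noncomputable def softmax {A : Type*} [Fintype A] (τ : ℝ) (f : A → ℝ) : A → ℝ :=
  fun a => Real.exp (f a / τ) / ∑ b, Real.exp (f b / τ)

/-- Theorem 1 of the paper (at a fixed time step, state and mean-field distribution):
the softmax of the Munchausen-regularized Q-function `Q̃^k = Q^k + τ·log π^{k-1}`,
where `π^{k-1} = softmax_τ(∑_{i=0}^{k-1} Q^i)`, equals the softmax of the sum
`∑_{i=0}^{k} Q^i`. -/
theorem softmax_regularizedQ_eq_softmax_sum {A : Type*} [Fintype A] [Nonempty A]
    (τ : ℝ) (hτ : 0 < τ) (k : ℕ) (hk : 1 ≤ k) (Q : ℕ → A → ℝ) :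
    softmax τ
      (fun a => Q k a +
        τ * Real.log (softmax τ (fun b => ∑ i ∈ Finset.range k, Q i b) a))
      = softmax τ (fun a => ∑ i ∈ Finset.range (k + 1), Q i a) := by
  have hZ : 0 < ∑ b, Real.exp ((∑ i ∈ Finset.range k, Q i b) / τ) :=
    Finset.sum_pos (fun b _ => Real.exp_pos _) Finset.univ_nonempty
  have key : ∀ a, Real.exp ((Q k a +
        τ * Real.log (softmax τ (fun b => ∑ i ∈ Finset.range k, Q i b) a)) / τ)
      = Real.exp ((∑ i ∈ Finset.range (k + 1), Q i a) / τ) /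
        ∑ b, Real.exp ((∑ i ∈ Finset.range k, Q i b) / τ) := by
    intro a
    have hp : 0 < softmax τ (fun b => ∑ i ∈ Finset.range k, Q i b) a :=
      div_pos (Real.exp_pos _) hZ
    rw [add_div, mul_div_cancel_left₀ _ hτ.ne', Real.exp_add, Real.exp_log hp,
      Finset.sum_range_succ, add_div, Real.exp_add, softmax]
    ring
  funext a
  change Real.exp ((Q k a +
        τ * Real.log (softmax τ (fun b => ∑ i ∈ Finset.range k, Q i b) a)) / τ) /
      (∑ c, Real.exp ((Q k c +
        τ * Real.log (softmax τ (fun b => ∑ i ∈ Finset.range k, Q i b) c)) / τ))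
      = Real.exp ((∑ i ∈ Finset.range (k + 1), Q i a) / τ) /
        ∑ b, Real.exp ((∑ i ∈ Finset.range (k + 1), Q i b) / τ)
  simp only [key]
  rw [← Finset.sum_div, div_div_div_cancel_right₀ hZ.ne']
end

section
/- Let A be a nonempty finite set, τ > 0, k ≥ 1, and Q^0, …, Q^k : A → ℝ. Set π^{k-1} = softmax_τ(Σ_{i=0}^{k-1} Q^i) and Q̃^k = Q^k + τ·log∘π^{k-1}. Then the two regularized objectives over the simplex Δ_A, F(π) = ⟨π, Q^k⟩ − τ·KL(π‖π^{k-1}) and G(π) = ⟨π, Q̃^k⟩ − τ·⟨π, ln π⟩, are equal as functions on Δ_A, and both are uniquely maximized at softmax_τ(Σ_{i=0}^{k} Q^i) = softmax_τ(Q̃^k). -/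
/-- The probability simplex on a finite set `A`. -/
def simplex (A : Type*) [Fintype A] : Set (A → ℝ) :=
  {π | (∀ a, 0 ≤ π a) ∧ ∑ a, π a = 1}

/-- Inner product `⟨π, f⟩ = ∑ a, π a * f a`. -/
noncomputable def ip {A : Type*} [Fintype A] (π f : A → ℝ) : ℝ := ∑ a, π a * f a

/-- Kullback–Leibler divergence `KL(π‖ρ) = ∑ a, π a * log (π a / ρ a)`
(with the convention `0 · log 0 = 0`, automatic since `Real.log 0 = 0`). -/
noncomputable def KL {A : Type*} [Fintype A] (π ρ : A → ℝ) : ℝ :=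
  ∑ a, π a * Real.log (π a / ρ a)

/-- Negative entropy term `⟨π, ln π⟩ = ∑ a, π a * log (π a)`
(with the convention `0 · log 0 = 0`, automatic since `Real.log 0 = 0`). -/
noncomputable def negEnt {A : Type*} [Fintype A] (π : A → ℝ) : ℝ :=
  ∑ a, π a * Real.log (π a)

theorem aux_Z_pos {A : Type*} [Fintype A] [Nonempty A] (τ : ℝ) (f : A → ℝ) :
    0 < ∑ b, Real.exp (f b / τ) :=
  Finset.sum_pos (fun _ _ => Real.exp_pos _) Finset.univ_nonempty

theorem aux_softmax_pos {A : Type*} [Fintype A] [Nonempty A] (τ : ℝ) (f : A → ℝ) (a : A) :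
    0 < softmax τ f a :=
  div_pos (Real.exp_pos _) (aux_Z_pos τ f)

theorem aux_softmax_mem {A : Type*} [Fintype A] [Nonempty A] (τ : ℝ) (f : A → ℝ) :
    softmax τ f ∈ simplex A := by
  refine ⟨fun a => (aux_softmax_pos τ f a).le, ?_⟩
  unfold softmax
  rw [← Finset.sum_div, div_self (aux_Z_pos τ f).ne']

theorem aux_log_softmax {A : Type*} [Fintype A] [Nonempty A] (τ : ℝ) (f : A → ℝ) (a : A) :
    Real.log (softmax τ f a) = f a / τ - Real.log (∑ b, Real.exp (f b / τ)) := by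
  unfold softmax
  rw [Real.log_div (Real.exp_pos _).ne' (aux_Z_pos τ f).ne', Real.log_exp]

theorem aux_softmax_shift {A : Type*} [Fintype A] (τ : ℝ) (hτ : 0 < τ) (f : A → ℝ) (c : ℝ) :
    softmax τ (fun a => f a + c) = softmax τ f := by
  funext a
  unfold softmax
  simp only [add_div, Real.exp_add]
  rw [← Finset.sum_mul, mul_div_mul_right _ _ (Real.exp_pos _).ne']

theorem aux_KL_eq {A : Type*} [Fintype A] (p r : A → ℝ) (hr : ∀ a, 0 < r a) :
    KL p r = ∑ a, p a * Real.log (p a) - ∑ a, p a * Real.log (r a) := by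
  unfold KL
  rw [← Finset.sum_sub_distrib]
  refine Finset.sum_congr rfl fun a _ => ?_
  by_cases h : p a = 0
  · simp [h]
  · rw [Real.log_div h (hr a).ne']; ring

theorem aux_KL_klFun {A : Type*} [Fintype A] (p r : A → ℝ) (hp : p ∈ simplex A)
    (hr : ∀ a, 0 < r a) (hr1 : r ∈ simplex A) :
    KL p r = ∑ a, r a * InformationTheory.klFun (p a / r a) := by
  have h : ∀ a, r a * InformationTheory.klFun (p a / r a)
      = p a * Real.log (p a / r a) + (r a - p a) := fun a => by
    have := (hr a).ne'
    unfold InformationTheory.klFun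
    field_simp
    ring
  simp only [h, Finset.sum_add_distrib, Finset.sum_sub_distrib, hp.2, hr1.2, KL]
  ring

theorem aux_KL_nonneg {A : Type*} [Fintype A] (p r : A → ℝ) (hp : p ∈ simplex A)
    (hr : ∀ a, 0 < r a) (hr1 : r ∈ simplex A) : 0 ≤ KL p r ∧ (KL p r = 0 ↔ p = r) := by
  have h0 : ∀ a ∈ Finset.univ, 0 ≤ r a * InformationTheory.klFun (p a / r a) := fun a _ =>
    mul_nonneg (hr a).le (InformationTheory.klFun_nonneg (div_nonneg (hp.1 a) (hr a).le))
  rw [aux_KL_klFun p r hp hr hr1]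
  refine ⟨Finset.sum_nonneg h0, ?_⟩
  rw [Finset.sum_eq_zero_iff_of_nonneg h0, funext_iff]
  refine forall_congr' fun a => ?_
  simp only [Finset.mem_univ, true_imp_iff, mul_eq_zero, (hr a).ne', false_or]
  rw [InformationTheory.klFun_eq_zero_iff (div_nonneg (hp.1 a) (hr a).le),
    div_eq_one_iff_eq (hr a).ne']

theorem aux_G_eq {A : Type*} [Fintype A] [Nonempty A] (τ : ℝ) (hτ : 0 < τ) (f p : A → ℝ)
    (hp : p ∈ simplex A) :
    ip p f - τ * negEnt p
      = τ * Real.log (∑ b, Real.exp (f b / τ)) - τ * KL p (softmax τ f) := by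
  rw [aux_KL_eq _ _ (aux_softmax_pos τ f)]
  simp only [aux_log_softmax, mul_sub, Finset.sum_sub_distrib]
  rw [← Finset.sum_mul, hp.2, Finset.mul_sum (f := fun a => p a * (f a / τ))]
  have : ∀ a, τ * (p a * (f a / τ)) = p a * f a := fun a => by field_simp
  simp only [this, ip, negEnt]
  ring

theorem aux_G_max {A : Type*} [Fintype A] [Nonempty A] (τ : ℝ) (hτ : 0 < τ) (f p : A → ℝ)
    (hp : p ∈ simplex A) :
    ip p f - τ * negEnt p ≤ ip (softmax τ f) f - τ * negEnt (softmax τ f) ∧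
    (ip p f - τ * negEnt p = ip (softmax τ f) f - τ * negEnt (softmax τ f)
      ↔ p = softmax τ f) := by
  have hs := aux_softmax_mem τ f
  have hpos := aux_softmax_pos τ f
  obtain ⟨h1, h2⟩ := aux_KL_nonneg p _ hp hpos hs
  have h3 := (aux_KL_nonneg _ _ hs hpos hs).2.2 rfl
  rw [aux_G_eq τ hτ f p hp, aux_G_eq τ hτ f _ hs, h3, ← h2]
  have h4 := mul_nonneg hτ.le h1
  refine ⟨by linarith, fun h => ?_, fun h => by rw [h]⟩
  have : τ * KL p (softmax τ f) = 0 := by linarith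
  exact (mul_eq_zero.1 this).resolve_left hτ.ne'

/-- With `π^{k-1} = softmax_τ(∑_{i<k} Q^i)` and `Q̃^k = Q^k + τ·log π^{k-1}`,
the objectives `F(π) = ⟨π, Q^k⟩ − τ·KL(π‖π^{k-1})` and
`G(π) = ⟨π, Q̃^k⟩ − τ·⟨π, ln π⟩` agree on the simplex, and both are uniquely
maximized at `softmax_τ(∑_{i≤k} Q^i) = softmax_τ(Q̃^k)`. -/
theorem regularized_objectives_agree_and_maximized {A : Type*} [Fintype A] [Nonempty A]
    (τ : ℝ) (hτ : 0 < τ) (k : ℕ) (hk : 1 ≤ k) (Q : ℕ → A → ℝ) :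
    let πkm1 := softmax τ (fun a => ∑ i ∈ Finset.range k, Q i a)
    let Qt : A → ℝ := fun a => Q k a + τ * Real.log (πkm1 a)
    let F : (A → ℝ) → ℝ := fun π => ip π (Q k) - τ * KL π πkm1
    let G : (A → ℝ) → ℝ := fun π => ip π Qt - τ * negEnt π
    let πstar := softmax τ (fun a => ∑ i ∈ Finset.range (k + 1), Q i a)
    (∀ π ∈ simplex A, F π = G π) ∧
      πstar = softmax τ Qt ∧
      πstar ∈ simplex A ∧
      (∀ π ∈ simplex A, F π ≤ F πstar ∧ (F π = F πstar ↔ π = πstar)) ∧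
      (∀ π ∈ simplex A, G π ≤ G πstar ∧ (G π = G πstar ↔ π = πstar)) := by
  intro πkm1 Qt F G πstar
  have hFG : ∀ π ∈ simplex A, F π = G π := by
    intro π _
    simp only [F, G]
    rw [aux_KL_eq π πkm1 (aux_softmax_pos τ _)]
    simp only [ip, Qt, negEnt, mul_add, Finset.sum_add_distrib, mul_sub]
    have : ∑ a, π a * (τ * Real.log (πkm1 a)) = τ * ∑ a, π a * Real.log (πkm1 a) := by
      rw [Finset.mul_sum]
      exact Finset.sum_congr rfl fun a _ => by ring
    rw [this]
    ring
  have hstar : πstar = softmax τ Qt := by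
    have hQ : Qt = fun a => (∑ i ∈ Finset.range (k + 1), Q i a)
        + -(τ * Real.log (∑ b, Real.exp ((∑ i ∈ Finset.range k, Q i b) / τ))) := by
      funext a
      simp only [Qt, πkm1, aux_log_softmax, Finset.sum_range_succ]
      field_simp
      ring
    rw [hQ, aux_softmax_shift τ hτ]
  have hmem : πstar ∈ simplex A := aux_softmax_mem τ _
  have hG : ∀ π ∈ simplex A, G π ≤ G πstar ∧ (G π = G πstar ↔ π = πstar) := by
    intro π hπ
    rw [hstar]
    exact aux_G_max τ hτ Qt π hπ
  refine ⟨hFG, hstar, hmem, fun π hπ => ?_, hG⟩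
  rw [hFG π hπ, hFG πstar hmem]
  exact hG π hπ
end
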